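/- For every integer e ≥ 1, the number m_1(e) of isomorphism classes of 1-rooted ribbon graphs with e edges equals (1/2^{e+1}) · Σ_{i=0}^{e} (−1)^i · Σ over all (i+1)-tuples (k_1,…,k_{i+1}) of positive integers with k_1 + ⋯ + k_{i+1} = e+1 of Π_{j=1}^{i+1} (2k_j)!/k_j!. -/

import Mathlib

open Finset

/-- A `1`-rooted ribbon graph with `e` edges: a pair of permutations `(α, σ)` of the
`2e` half-edges, where `α` is a fixed-point-free involution and `⟨α, σ⟩` acts
transitively, together with a distinguished half-edge (the root). -/
structure OneRootedRibbonGraph (e : ℕ) where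
  α : Equiv.Perm (Fin (2 * e))
  σ : Equiv.Perm (Fin (2 * e))
  α_invol : ∀ x, α (α x) = x
  α_fixfree : ∀ x, α x ≠ x
  transitive : ∀ x y : Fin (2 * e),
    ∃ g ∈ Subgroup.closure ({α, σ} : Set (Equiv.Perm (Fin (2 * e)))), g x = y
  root : Fin (2 * e)

/-- Isomorphism of 1-rooted ribbon graphs: a relabelling `ψ` of half-edges conjugating
`α` to `α'` and `σ` to `σ'` and sending the root to the root. -/
def RGIso1 {e : ℕ} (G G' : OneRootedRibbonGraph e) : Prop :=
  ∃ ψ : Equiv.Perm (Fin (2 * e)),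
    G'.α = ψ * G.α * ψ⁻¹ ∧ G'.σ = ψ * G.σ * ψ⁻¹ ∧ ψ G.root = G'.root

/-- `m1RG e` is the number of isomorphism classes of 1-rooted ribbon graphs
with `e` edges. -/
noncomputable def m1RG (e : ℕ) : ℕ := Nat.card (Quot (@RGIso1 e))

/-- The number `(2k)! / (2^k k!) = (2k-1)!!` of perfect matchings of `2k` points. -/
def matchingNumber (k : ℕ) : ℚ := (2 * k).factorial / (2 ^ k * k.factorial)

theorem matchingNumber_zero : matchingNumber 0 = 1 := by simp [matchingNumber]

theorem matchingNumber_succ (k : ℕ) :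
    matchingNumber (k + 1) = (2 * k + 1) * matchingNumber k := by
  have h : ((k.factorial : ℕ) : ℚ) ≠ 0 := by positivity
  simp only [matchingNumber, show 2 * (k + 1) = 2 * k + 1 + 1 by ring, Nat.factorial_succ]
  push_cast
  field_simp
  ring

theorem PowerSeries.coeff_sub_one_pow_eq_sum {R : Type*} [CommRing R] {a : ℕ → R} (ha : a 0 = 1)
    (n m : ℕ) :
    PowerSeries.coeff m ((PowerSeries.mk a - 1) ^ n) =
      ∑ κ ∈ (Finset.Nat.antidiagonalTuple n m).filter (fun κ => ∀ j, 0 < κ j),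
        ∏ j, a (κ j) := by
  have hprod : (PowerSeries.mk a - 1) ^ n = ∏ _j : Fin n, (PowerSeries.mk a - 1) := by simp
  have hcoeff (l : ℕ) :
      PowerSeries.coeff l (PowerSeries.mk a - 1) = if 0 < l then a l else 0 := by
    rcases Nat.eq_zero_or_pos l with rfl | hl
    · simp [ha]
    · simp [PowerSeries.coeff_one, hl, hl.ne']
  rw [hprod, PowerSeries.coeff_prod, Finset.sum_filter]
  simp only [hcoeff]
  refine Finset.sum_nbij' (fun l => l) (fun κ => Finsupp.equivFunOnFinite.symm κ) ?_ ?_ ?_ ?_ ?_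
  · intro l hl
    simpa [Finset.Nat.mem_antidiagonalTuple] using hl
  · intro κ hκ
    simpa [Finset.Nat.mem_antidiagonalTuple] using hκ
  · intro l _
    simp
  · intro κ _
    simp
  · intro l _
    split_ifs with h
    · exact Finset.prod_congr rfl fun j _ => if_pos (h j)
    · push Not at h
      obtain ⟨j, hj⟩ := h
      exact Finset.prod_eq_zero (Finset.mem_univ j) (if_neg hj.not_gt)

theorem PowerSeries.coeff_eq_alternating_sum_of_mul_eq {R : Type*} [CommRing R]
    {A N : PowerSeries R} (hA : PowerSeries.constantCoeff A = 1) (hN : N * A = A - 1) (e : ℕ) :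
    PowerSeries.coeff (e + 1) N =
      ∑ i ∈ range (e + 1), (-1) ^ i * PowerSeries.coeff (e + 1) ((A - 1) ^ (i + 1)) := by
  set C : PowerSeries R := ∑ i ∈ range (e + 1), (-1) ^ i * (A - 1) ^ (i + 1) with hC
  have hgeom : C * A = (A - 1) * (1 - (-(A - 1)) ^ (e + 1)) := by
    have h := geom_sum_mul (-(A - 1)) (e + 1)
    have hC' : C = (A - 1) * ∑ i ∈ range (e + 1), (-(A - 1)) ^ i := by
      rw [hC, Finset.mul_sum]
      refine Finset.sum_congr rfl fun i _ => ?_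
      rw [neg_pow (A - 1), pow_succ]
      ring
    rw [hC']
    linear_combination (-(A - 1)) * h
  have hunit : IsUnit A := PowerSeries.isUnit_iff_constantCoeff.2 (by simp [hA])
  obtain ⟨B, hB⟩ := hunit.exists_right_inv
  have hdvd : PowerSeries.X ^ (e + 2) ∣ N - C := by
    have hX : PowerSeries.X ∣ -(A - 1) :=
      PowerSeries.X_dvd_iff.2 (by simp [hA])
    have : N - C = -((-(A - 1)) ^ (e + 2)) * B := by
      linear_combination (B * hN) - B * hgeom - (N - C) * hB
    rw [this]
    exact ((pow_dvd_pow_of_dvd hX _).neg_right).mul_right _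
  have h0 := PowerSeries.X_pow_dvd_iff.1 hdvd (e + 1) (by omega)
  rw [map_sub, sub_eq_zero] at h0
  rw [h0, hC, map_sum]
  refine Finset.sum_congr rfl fun i _ => ?_
  rcases Nat.even_or_odd i with hi | hi <;> simp [hi.neg_one_pow]

/-- A sequence convolving with the matching numbers to `2n · matchingNumber n` is
determined by the alternating sum over compositions. -/
theorem eq_alternating_sum_of_convolution {m : ℕ → ℚ}
    (hm : ∀ n, ∑ p ∈ antidiagonal n, m p.1 * matchingNumber p.2 = 2 * n * matchingNumber n)
    {e : ℕ} (he : 1 ≤ e) :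
    m e = ∑ i ∈ range (e + 1), (-1 : ℚ) ^ i *
      ∑ κ ∈ (Finset.Nat.antidiagonalTuple (i + 1) (e + 1)).filter (fun κ => ∀ j, 0 < κ j),
        ∏ j, matchingNumber (κ j) := by
  have hN : (PowerSeries.X * (PowerSeries.mk m + 1)) * PowerSeries.mk matchingNumber =
      PowerSeries.mk matchingNumber - 1 := by
    ext n
    rw [mul_assoc]
    cases n with
    | zero => simp [matchingNumber_zero]
    | succ n =>
      rw [PowerSeries.coeff_succ_X_mul, add_mul, one_mul, map_add, PowerSeries.coeff_mul]
      simp only [PowerSeries.coeff_mk, map_sub, PowerSeries.coeff_one, hm, matchingNumber_succ]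
      simp
      ring
  have h := PowerSeries.coeff_eq_alternating_sum_of_mul_eq
    (by simp [matchingNumber_zero]) hN e
  simp only [PowerSeries.coeff_sub_one_pow_eq_sum matchingNumber_zero] at h
  rw [← h, PowerSeries.coeff_succ_X_mul, map_add, PowerSeries.coeff_mk, PowerSeries.coeff_one,
    if_neg (by omega), add_zero]

theorem prod_matchingNumber {n m : ℕ} {κ : Fin n → ℕ} (hκ : ∑ j, κ j = m) :
    ∏ j, matchingNumber (κ j) =
      1 / 2 ^ m * ∏ j, ((2 * κ j).factorial : ℚ) / ((κ j).factorial : ℚ) := by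
  have h2 : (2 : ℚ) ^ m = ∏ j, 2 ^ κ j := by rw [Finset.prod_pow_eq_pow_sum, hκ]
  rw [h2, one_div, ← Finset.prod_inv_distrib, ← Finset.prod_mul_distrib]
  refine Finset.prod_congr rfl fun j _ => ?_
  rw [matchingNumber, div_mul_eq_div_div, div_right_comm]
  ring

/-- A fixed-point-free involution. -/
def IsMatching {X : Type} (α : Equiv.Perm X) : Prop := ∀ x, α (α x) = x ∧ α x ≠ x

/-- Every set that contains `r` and is stable under `α` and `σ` is everything. -/
def ReachesAll {X : Type} (α σ : Equiv.Perm X) (r : X) : Prop :=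
  ∀ S : Set X, r ∈ S → Set.MapsTo α S S → Set.MapsTo σ S S → S = Set.univ

/-- Possibly disconnected ribbon graphs with set of half-edges `X`. -/
abbrev RibbonPair (X : Type) : Type := {α : Equiv.Perm X // IsMatching α} × Equiv.Perm X

/-- Rooted connected ribbon graphs with set of half-edges `X`. -/
abbrev RootedMap (X : Type) : Type :=
  {p : Equiv.Perm X × Equiv.Perm X × X // IsMatching p.1 ∧ ReachesAll p.1 p.2.1 p.2.2}

theorem IsMatching.permCongr {X Y : Type} (f : X ≃ Y) {α : Equiv.Perm X} (h : IsMatching α) :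
    IsMatching (f.permCongr α) := fun y => by
  simpa [Equiv.permCongr_apply, ← Equiv.eq_symm_apply] using h (f.symm y)

theorem permCongr_symm_permCongr {X Y : Type} (f : X ≃ Y) (α : Equiv.Perm X) :
    f.symm.permCongr (f.permCongr α) = α :=
  f.permCongr.symm_apply_apply α

theorem isMatching_permCongr_iff {X Y : Type} (f : X ≃ Y) {α : Equiv.Perm X} :
    IsMatching (f.permCongr α) ↔ IsMatching α :=
  ⟨fun h => permCongr_symm_permCongr f α ▸ h.permCongr f.symm, fun h => h.permCongr f⟩

theorem ReachesAll.permCongr {X Y : Type} (f : X ≃ Y) {α σ : Equiv.Perm X} {r : X}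
    (h : ReachesAll α σ r) : ReachesAll (f.permCongr α) (f.permCongr σ) (f r) := by
  intro S hr hα hσ
  have hS := h (f ⁻¹' S) hr
    (fun x hx => by simpa [Equiv.permCongr_apply] using hα hx)
    (fun x hx => by simpa [Equiv.permCongr_apply] using hσ hx)
  rwa [Set.preimage_eq_univ_iff, f.surjective.range_eq, Set.univ_subset_iff] at hS

theorem reachesAll_permCongr_iff {X Y : Type} (f : X ≃ Y) {α σ : Equiv.Perm X} {r : X} :
    ReachesAll (f.permCongr α) (f.permCongr σ) (f r) ↔ ReachesAll α σ r :=
  ⟨fun h => by simpa [permCongr_symm_permCongr] using h.permCongr f.symm, fun h => h.permCongr f⟩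

theorem card_ribbonPair_congr {X Y : Type} (f : X ≃ Y) :
    Nat.card (RibbonPair X) = Nat.card (RibbonPair Y) :=
  Nat.card_congr <| Equiv.prodCongr
    (f.permCongr.subtypeEquiv fun _ => (isMatching_permCongr_iff f).symm) f.permCongr

theorem card_rootedMap_congr {X Y : Type} (f : X ≃ Y) :
    Nat.card (RootedMap X) = Nat.card (RootedMap Y) :=
  Nat.card_congr <| (f.permCongr.prodCongr (f.permCongr.prodCongr f)).subtypeEquiv fun _ =>
    and_congr (isMatching_permCongr_iff f).symm (reachesAll_permCongr_iff f).symm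

theorem IsMatching.subtypeCongr {X : Type} {p : X → Prop} [DecidablePred p]
    {α : Equiv.Perm {x // p x}} {β : Equiv.Perm {x // ¬p x}} (hα : IsMatching α)
    (hβ : IsMatching β) : IsMatching (Equiv.Perm.subtypeCongr α β) := by
  intro x
  by_cases hx : p x
  · have := hα ⟨x, hx⟩
    rw [Equiv.Perm.subtypeCongr.left_apply _ _ hx, Equiv.Perm.subtypeCongr.left_apply_subtype]
    simpa [Subtype.ext_iff] using this
  · have := hβ ⟨x, hx⟩
    rw [Equiv.Perm.subtypeCongr.right_apply _ _ hx, Equiv.Perm.subtypeCongr.right_apply_subtype]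
    simpa [Subtype.ext_iff] using this

theorem IsMatching.subtypePerm {X : Type} {p : X → Prop} {α : Equiv.Perm X} (hα : IsMatching α)
    (h : ∀ x, p (α x) ↔ p x) : IsMatching (α.subtypePerm h) := fun x => by
  simpa [Subtype.ext_iff] using hα x

/-- Glue a rooted connected ribbon graph on `S` and a ribbon graph on the complement of `S`. -/
def glue {X : Type} [DecidableEq X]
    (d : Σ S : Finset X, RootedMap {x // x ∈ S} × RibbonPair {x // x ∉ S}) : RibbonPair X × X :=
  ((⟨Equiv.Perm.subtypeCongr d.2.1.1.1 d.2.2.1.1, d.2.1.2.1.subtypeCongr d.2.2.1.2⟩,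
    Equiv.Perm.subtypeCongr d.2.1.1.2.1 d.2.2.2), d.2.1.1.2.2)

theorem mapsTo_subtypeCongr {X : Type} [DecidableEq X] {S : Finset X}
    (α : Equiv.Perm {x // x ∈ S}) (β : Equiv.Perm {x // x ∉ S}) :
    Set.MapsTo (Equiv.Perm.subtypeCongr α β) S S := fun x hx => by
  rw [Equiv.Perm.subtypeCongr.left_apply _ _ (Finset.mem_coe.1 hx)]
  exact (α _).2

theorem ReachesAll.subset {X : Type} [DecidableEq X] {S : Finset X} {α σ : Equiv.Perm {x // x ∈ S}}
    {r : {x // x ∈ S}} (h : ReachesAll α σ r) {β τ : Equiv.Perm {x // x ∉ S}} {T : Set X}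
    (hr : (r : X) ∈ T) (hα : Set.MapsTo (Equiv.Perm.subtypeCongr α β) T T)
    (hσ : Set.MapsTo (Equiv.Perm.subtypeCongr σ τ) T T) : (S : Set X) ⊆ T := by
  intro x hx
  have hT := h (Subtype.val ⁻¹' T) hr
    (fun y hy => by simpa using hα hy) (fun y hy => by simpa using hσ hy)
  exact (hT ▸ Set.mem_univ _ : (⟨x, hx⟩ : {x // x ∈ S}) ∈ Subtype.val ⁻¹' T)

theorem glue_injective {X : Type} [DecidableEq X] : Function.Injective (glue (X := X)) := by
  rintro ⟨S, ⟨⟨α, σ, r⟩, hα, hr⟩, ⟨β, hβ⟩, τ⟩ ⟨S', ⟨⟨α', σ', r'⟩, hα', hr'⟩, ⟨β', hβ'⟩, τ'⟩ h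
  simp only [glue, Prod.mk.injEq, Subtype.mk.injEq] at h
  obtain ⟨⟨h₁, h₂⟩, h₃⟩ := h
  dsimp only at hα hr hα' hr'
  obtain rfl : S = S' := by
    apply Finset.coe_injective
    apply Set.Subset.antisymm
    · exact hr.subset (h₃ ▸ r'.2) (h₁ ▸ mapsTo_subtypeCongr α' β') (h₂ ▸ mapsTo_subtypeCongr σ' τ')
    · exact hr'.subset (h₃ ▸ r.2) (h₁ ▸ mapsTo_subtypeCongr α β) (h₂ ▸ mapsTo_subtypeCongr σ τ)
  have hinj := Equiv.Perm.subtypeCongrHom_injective (· ∈ S)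
  obtain ⟨rfl, rfl⟩ := Prod.mk.inj (hinj (a₁ := (α, β)) (a₂ := (α', β')) h₁)
  obtain ⟨rfl, rfl⟩ := Prod.mk.inj (hinj (a₁ := (σ, τ)) (a₂ := (σ', τ')) h₂)
  obtain rfl := Subtype.ext h₃
  rfl

theorem Equiv.Perm.mem_iff_of_mapsTo {X : Type} [Finite X] {α : Equiv.Perm X} {S : Set X}
    (h : Set.MapsTo α S S) (x : X) : α x ∈ S ↔ x ∈ S := by
  refine ⟨fun hx => ?_, fun hx => h hx⟩
  have himg : α '' S = S := Set.eq_of_subset_of_ncard_le h.image_subset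
    (Set.ncard_image_of_injective S α.injective).ge
  obtain ⟨y, hy, hyx⟩ := himg.symm ▸ hx
  exact α.injective hyx ▸ hy

theorem glue_surjective {X : Type} [Fintype X] [DecidableEq X] :
    Function.Surjective (glue (X := X)) := by
  classical
  rintro ⟨⟨⟨α, hα⟩, σ⟩, r⟩
  set O : Set X := {y | Relation.ReflTransGen (fun x y => y = α x ∨ y = σ x) r y}
  have hαO : Set.MapsTo α O O := fun x hx => hx.tail (Or.inl rfl)
  have hσO : Set.MapsTo σ O O := fun x hx => hx.tail (Or.inr rfl)
  have hrO : r ∈ O := Relation.ReflTransGen.refl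
  have hmin (T : Set X) (hr : r ∈ T) (h : ∀ x ∈ T, x ∈ O → α x ∈ T ∧ σ x ∈ T) : O ⊆ T := by
    intro y hy
    induction hy with
    | refl => exact hr
    | tail hb hbc ih =>
      rcases hbc with rfl | rfl
      · exact (h _ ih hb).1
      · exact (h _ ih hb).2
  set S : Finset X := O.toFinset with hS
  have hSO (x : X) : x ∈ S ↔ x ∈ O := by simp [hS]
  have hαS (x : X) : α x ∈ S ↔ x ∈ S := by
    simpa only [hSO] using Equiv.Perm.mem_iff_of_mapsTo hαO x
  have hσS (x : X) : σ x ∈ S ↔ x ∈ S := by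
    simpa only [hSO] using Equiv.Perm.mem_iff_of_mapsTo hσO x
  have hreach : ReachesAll (α.subtypePerm hαS) (σ.subtypePerm hσS) ⟨r, (hSO r).2 hrO⟩ := by
    intro T hr hαT hσT
    have := hmin (Subtype.val '' T) ⟨_, hr, rfl⟩ (by
      rintro _ ⟨x, hx, rfl⟩ -
      exact ⟨⟨_, hαT hx, rfl⟩, ⟨_, hσT hx, rfl⟩⟩)
    refine Set.eq_univ_of_forall fun x => ?_
    obtain ⟨y, hy, hyx⟩ := this ((hSO x).1 x.2)
    exact Subtype.ext hyx ▸ hy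
  have hglue (π : Equiv.Perm X) (hπ : ∀ x, π x ∈ S ↔ x ∈ S) :
      Equiv.Perm.subtypeCongr (π.subtypePerm hπ)
        (π.subtypePerm (p := (· ∉ S)) fun x => not_congr (hπ x)) = π := by
    ext x
    by_cases hx : x ∈ S
    · rw [Equiv.Perm.subtypeCongr.left_apply _ _ hx]; rfl
    · rw [Equiv.Perm.subtypeCongr.right_apply _ _ hx]; rfl
  refine ⟨⟨S, ⟨⟨α.subtypePerm hαS, σ.subtypePerm hσS, ⟨r, (hSO r).2 hrO⟩⟩,
    hα.subtypePerm hαS, hreach⟩,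
    ⟨α.subtypePerm fun x => not_congr (hαS x), hα.subtypePerm fun x => not_congr (hαS x)⟩,
    σ.subtypePerm fun x => not_congr (hσS x)⟩, ?_⟩
  simp only [glue, Prod.mk.injEq, Subtype.mk.injEq]
  exact ⟨⟨hglue α hαS, hglue σ hσS⟩, trivial⟩

theorem card_ribbonPair_mul (n : ℕ) :
    Nat.card (RibbonPair (Fin n)) * n =
      ∑ k ∈ range (n + 1), n.choose k *
        (Nat.card (RootedMap (Fin k)) * Nat.card (RibbonPair (Fin (n - k)))) := by
  have h := Nat.card_congr
    (Equiv.ofBijective (glue (X := Fin n)) ⟨glue_injective, glue_surjective⟩)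
  rw [Nat.card_prod, Nat.card_fin, Nat.card_sigma] at h
  rw [← h]
  have hsum := Finset.sum_powerset_apply_card
    (fun k => Nat.card (RootedMap (Fin k)) * Nat.card (RibbonPair (Fin (n - k))))
    (x := (Finset.univ : Finset (Fin n)))
  simp only [Finset.powerset_univ, Finset.card_univ, Fintype.card_fin, smul_eq_mul] at hsum
  rw [← hsum]
  refine Finset.sum_congr rfl fun S _ => ?_
  rw [Nat.card_prod]
  congr 1
  · exact card_rootedMap_congr (Fintype.equivFinOfCardEq (by simp))
  · exact card_ribbonPair_congr (Fintype.equivFinOfCardEq (by simp [Fintype.card_subtype_compl]))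

theorem IsMatching.cycleType {X : Type} [Fintype X] [DecidableEq X] {α : Equiv.Perm X}
    (hα : IsMatching α) :
    (∀ c ∈ α.cycleType, c = 2) ∧ α.cycleType.sum = Fintype.card X := by
  have : Fact (Nat.Prime 2) := ⟨Nat.prime_two⟩
  refine ⟨Equiv.Perm.pow_prime_eq_one_iff.1 (Equiv.ext fun x => ?_), ?_⟩
  · simpa [sq] using (hα x).1
  · rw [Equiv.Perm.sum_cycleType, ← Finset.card_univ]
    congr 1
    exact Finset.eq_univ_of_forall fun x => Equiv.Perm.mem_support.2 (hα x).2

theorem isMatching_iff_cycleType {n : ℕ} {α : Equiv.Perm (Fin (2 * n))} :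
    IsMatching α ↔ α.cycleType = Multiset.replicate n 2 := by
  have : Fact (Nat.Prime 2) := ⟨Nat.prime_two⟩
  refine ⟨fun h => ?_, fun h x => ⟨?_, ?_⟩⟩
  · obtain ⟨h2, hs⟩ := h.cycleType
    have hr := Multiset.eq_replicate_card.2 h2
    rw [hr, Multiset.sum_replicate, Fintype.card_fin, smul_eq_mul, mul_comm] at hs
    rw [hr, Nat.eq_of_mul_eq_mul_left two_pos hs]
  · have h2 : α ^ 2 = 1 := Equiv.Perm.pow_prime_eq_one_iff.2
      (by rw [h]; exact fun c => Multiset.eq_of_mem_replicate)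
    simpa [sq] using Equiv.congr_fun h2 x
  · have hs : α.support = Finset.univ := by
      rw [← Finset.card_eq_iff_eq_univ, ← Equiv.Perm.sum_cycleType, h]
      simp [mul_comm]
    exact Equiv.Perm.mem_support.1 (hs ▸ Finset.mem_univ x)

theorem card_ribbonPair_even (n : ℕ) :
    (Nat.card (RibbonPair (Fin (2 * n))) : ℚ) = matchingNumber n * (2 * n).factorial := by
  have h := Equiv.Perm.card_of_cycleType_mul_eq (Fin (2 * n)) (Multiset.replicate n 2)
  rw [if_pos ⟨by simp [mul_comm], by simp +contextual [Multiset.mem_replicate]⟩] at h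
  have hprod : ∏ c ∈ (Multiset.replicate n 2).toFinset,
      ((Multiset.replicate n 2).count c).factorial = n.factorial := by
    rcases Nat.eq_zero_or_pos n with rfl | hn
    · simp
    · rw [Multiset.toFinset_replicate, if_neg hn.ne', Finset.prod_singleton,
        Multiset.count_replicate_self]
  have hcard : Nat.card {α : Equiv.Perm (Fin (2 * n)) // IsMatching α} =
      #{α : Equiv.Perm (Fin (2 * n)) | α.cycleType = Multiset.replicate n 2} := by
    rw [← Fintype.card_subtype, ← Nat.card_eq_fintype_card]
    exact Nat.card_congr (Equiv.subtypeEquivRight fun _ => isMatching_iff_cycleType)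
  rw [hprod, ← hcard] at h
  simp only [Fintype.card_fin, Multiset.sum_replicate, smul_eq_mul, mul_comm n 2, Nat.sub_self,
    Nat.factorial_zero, one_mul, Multiset.prod_replicate] at h
  rw [Nat.card_prod, Nat.card_perm, Nat.card_fin, Nat.cast_mul, matchingNumber, ← h]
  push_cast
  field_simp

theorem isEmpty_rootedMap_of_odd {n : ℕ} (hn : Odd n) : IsEmpty (RootedMap (Fin n)) := by
  refine ⟨fun p => ?_⟩
  obtain ⟨h2, hs⟩ := p.2.1.cycleType
  rw [Multiset.eq_replicate_card.2 h2, Multiset.sum_replicate, Fintype.card_fin, smul_eq_mul] at hs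
  exact Nat.not_even_iff_odd.2 hn (hs ▸ even_two.mul_left _)

theorem Equiv.Perm.mem_of_mem_closure {X : Type} [Finite X] {s : Set (Equiv.Perm X)} {S : Set X}
    (hs : ∀ π ∈ s, Set.MapsTo π S S) {g : Equiv.Perm X} (hg : g ∈ Subgroup.closure s) {x : X} :
    g x ∈ S ↔ x ∈ S := by
  induction hg using Subgroup.closure_induction generalizing x with
  | mem π hπ => exact Equiv.Perm.mem_iff_of_mapsTo (hs π hπ) x
  | one => rfl
  | mul a b _ _ ha hb => rw [Equiv.Perm.mul_apply, ha, hb]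
  | inv a _ ha => rw [← ha, ← Equiv.Perm.mul_apply, mul_inv_cancel, Equiv.Perm.one_apply]

theorem OneRootedRibbonGraph.reachesAll {e : ℕ} (G : OneRootedRibbonGraph e) :
    ReachesAll G.α G.σ G.root := by
  intro S hr hα hσ
  refine Set.eq_univ_of_forall fun x => ?_
  obtain ⟨g, hg, rfl⟩ := G.transitive G.root x
  exact (Equiv.Perm.mem_of_mem_closure (by rintro π (rfl | rfl) <;> assumption) hg).2 hr

theorem ReachesAll.transitive {X : Type} {α σ : Equiv.Perm X} {r : X}
    (h : ReachesAll α σ r) (x y : X) :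
    ∃ g ∈ Subgroup.closure ({α, σ} : Set (Equiv.Perm X)), g x = y := by
  have key : {y | ∃ g ∈ Subgroup.closure ({α, σ} : Set (Equiv.Perm X)), g r = y} = Set.univ := by
    apply h
    · exact ⟨1, one_mem _, rfl⟩
    · rintro _ ⟨g, hg, rfl⟩
      exact ⟨α * g, mul_mem (Subgroup.subset_closure (by simp)) hg, rfl⟩
    · rintro _ ⟨g, hg, rfl⟩
      exact ⟨σ * g, mul_mem (Subgroup.subset_closure (by simp)) hg, rfl⟩
  obtain ⟨a, ha, rfl⟩ := Set.eq_univ_iff_forall.1 key x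
  obtain ⟨b, hb, rfl⟩ := Set.eq_univ_iff_forall.1 key y
  exact ⟨b * a⁻¹, mul_mem hb (inv_mem ha), by simp⟩

/-- A connected ribbon graph on `Fin (2 * e)` with a root, as a `RootedMap`. -/
def OneRootedRibbonGraph.equivRootedMap (e : ℕ) :
    OneRootedRibbonGraph e ≃ RootedMap (Fin (2 * e)) where
  toFun G := ⟨(G.α, G.σ, G.root), fun x => ⟨G.α_invol x, G.α_fixfree x⟩, G.reachesAll⟩
  invFun p :=
    { α := p.1.1
      σ := p.1.2.1
      α_invol := fun x => (p.2.1 x).1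
      α_fixfree := fun x => (p.2.1 x).2
      transitive := p.2.2.transitive
      root := p.1.2.2 }
  left_inv _ := rfl
  right_inv _ := rfl

theorem rgIso1_equivalence (e : ℕ) : Equivalence (@RGIso1 e) where
  refl G := ⟨1, by simp, by simp, rfl⟩
  symm := by
    rintro G G' ⟨ψ, h₁, h₂, h₃⟩
    refine ⟨ψ⁻¹, ?_, ?_, ?_⟩
    · rw [h₁]; group
    · rw [h₂]; group
    · rw [← h₃, ← Equiv.Perm.mul_apply, inv_mul_cancel, Equiv.Perm.one_apply]
  trans := by
    rintro G G' G'' ⟨ψ, h₁, h₂, h₃⟩ ⟨ψ', h₁', h₂', h₃'⟩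
    refine ⟨ψ' * ψ, ?_, ?_, ?_⟩
    · rw [h₁', h₁]; group
    · rw [h₂', h₂]; group
    · rw [Equiv.Perm.mul_apply, h₃, h₃']

/-- Rename the half-edges of a rooted ribbon graph. -/
def OneRootedRibbonGraph.transport {e : ℕ} (ψ : Equiv.Perm (Fin (2 * e)))
    (G : OneRootedRibbonGraph e) : OneRootedRibbonGraph e where
  α := ψ * G.α * ψ⁻¹
  σ := ψ * G.σ * ψ⁻¹
  α_invol x := by simp [G.α_invol]
  α_fixfree x := by simpa [← Equiv.Perm.eq_inv_iff_eq] using G.α_fixfree (ψ⁻¹ x)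
  transitive := (G.reachesAll.permCongr ψ).transitive
  root := ψ G.root

theorem OneRootedRibbonGraph.ext' {e : ℕ} {G G' : OneRootedRibbonGraph e} (h₁ : G.α = G'.α)
    (h₂ : G.σ = G'.σ) (h₃ : G.root = G'.root) : G = G' := by
  cases G; cases G'; congr

theorem OneRootedRibbonGraph.transport_injective {e : ℕ} (G : OneRootedRibbonGraph e) :
    Function.Injective fun ψ => G.transport ψ := by
  intro ψ ψ' h
  have h₁ : ψ * G.α * ψ⁻¹ = ψ' * G.α * ψ'⁻¹ := congrArg OneRootedRibbonGraph.α h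
  have h₂ : ψ * G.σ * ψ⁻¹ = ψ' * G.σ * ψ'⁻¹ := congrArg OneRootedRibbonGraph.σ h
  have h₃ : ψ G.root = ψ' G.root := congrArg OneRootedRibbonGraph.root h
  have hcomm {π : Equiv.Perm (Fin (2 * e))} (hπ : ψ * π * ψ⁻¹ = ψ' * π * ψ'⁻¹)
      {x : Fin (2 * e)} (hx : ψ x = ψ' x) : ψ (π x) = ψ' (π x) := by
    have h := Equiv.congr_fun hπ (ψ x)
    rw [Equiv.Perm.mul_apply, Equiv.Perm.mul_apply, Equiv.Perm.mul_apply, Equiv.Perm.mul_apply,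
      ← Equiv.Perm.mul_apply ψ⁻¹ ψ, inv_mul_cancel, hx, ← Equiv.Perm.mul_apply ψ'⁻¹ ψ',
      inv_mul_cancel] at h
    exact h
  have hfix := G.reachesAll {x | ψ x = ψ' x} h₃ (fun x => hcomm h₁) (fun x => hcomm h₂)
  exact Equiv.ext (Set.eq_univ_iff_forall.1 hfix)

theorem card_rootedMap_even (e : ℕ) :
    Nat.card (RootedMap (Fin (2 * e))) = m1RG e * (2 * e).factorial := by
  let f : Quot (@RGIso1 e) × Equiv.Perm (Fin (2 * e)) → OneRootedRibbonGraph e :=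
    fun p => p.1.out.transport p.2
  have hmk (p) : Quot.mk RGIso1 (f p) = p.1 := by
    conv_rhs => rw [← Quot.out_eq p.1]
    exact (Quot.sound ⟨p.2, rfl, rfl, rfl⟩).symm
  have hf : Function.Bijective f := by
    constructor
    · rintro ⟨q, ψ⟩ ⟨q', ψ'⟩ h
      obtain rfl : q = q' := (hmk (q, ψ)).symm.trans ((congrArg _ h).trans (hmk (q', ψ')))
      exact Prod.ext rfl (q.out.transport_injective h)
    · intro G
      obtain ⟨ψ, h₁, h₂, h₃⟩ := ((rgIso1_equivalence e).quot_mk_eq_iff _ _).1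
        (Quot.out_eq (Quot.mk RGIso1 G))
      exact ⟨(Quot.mk RGIso1 G, ψ), OneRootedRibbonGraph.ext' h₁.symm h₂.symm h₃⟩
  rw [← Nat.card_congr (OneRootedRibbonGraph.equivRootedMap e), ← Nat.card_eq_of_bijective f hf,
    Nat.card_prod, Nat.card_perm, Nat.card_fin, m1RG]

theorem sum_range_two_mul_add_one_of_odd {M : Type*} [AddCommMonoid M] {f : ℕ → M}
    (hf : ∀ k, Odd k → f k = 0) (n : ℕ) :
    ∑ k ∈ range (2 * n + 1), f k = ∑ k ∈ range (n + 1), f (2 * k) := by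
  induction n with
  | zero => simp
  | succ n ih =>
    rw [show 2 * (n + 1) + 1 = 2 * n + 1 + 1 + 1 by ring, sum_range_succ, sum_range_succ, ih,
      sum_range_succ _ (n + 1), hf (2 * n + 1) (by simp), add_zero]
    rfl

theorem m1RG_convolution (n : ℕ) :
    ∑ p ∈ antidiagonal n, (m1RG p.1 : ℚ) * matchingNumber p.2 = 2 * n * matchingNumber n := by
  have h := card_ribbonPair_mul (2 * n)
  rw [sum_range_two_mul_add_one_of_odd] at h
  swap
  · intro k hk
    have := isEmpty_rootedMap_of_odd hk
    simp
  have hq := congrArg (Nat.cast (R := ℚ)) h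
  push_cast at hq
  rw [card_ribbonPair_even, ← Finset.Nat.sum_antidiagonal_eq_sum_range_succ_mk
    (f := fun p => ((2 * n).choose (2 * p.1) : ℚ) * ((Nat.card (RootedMap (Fin (2 * p.1))) : ℚ) *
      (Nat.card (RibbonPair (Fin (2 * n - 2 * p.1))) : ℚ)))] at hq
  have hterm : ∀ p ∈ antidiagonal n,
      ((2 * n).choose (2 * p.1) : ℚ) * ((Nat.card (RootedMap (Fin (2 * p.1))) : ℚ) *
        (Nat.card (RibbonPair (Fin (2 * n - 2 * p.1))) : ℚ)) =
      (m1RG p.1 : ℚ) * matchingNumber p.2 * (2 * n).factorial := by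
    rintro ⟨i, j⟩ hp
    obtain rfl : i + j = n := mem_antidiagonal.1 hp
    have hc := Nat.add_choose_mul_factorial_mul_factorial (2 * i) (2 * j)
    rw [← mul_add, ← Nat.choose_symm_of_eq_add (mul_add 2 i j)] at hc
    rw [show 2 * (i + j) - 2 * i = 2 * j by omega, card_rootedMap_even, card_ribbonPair_even, ← hc]
    push_cast
    ring
  rw [Finset.sum_congr rfl hterm, ← Finset.sum_mul] at hq
  have hfac : ((2 * n).factorial : ℚ) ≠ 0 := by positivity
  apply mul_right_cancel₀ hfac
  rw [← hq]
  ring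

/-- The Arquès–Béraud formula: for every `e ≥ 1`, the number of
isomorphism classes of 1-rooted ribbon graphs with `e` edges equals
`(1/2^{e+1}) Σ_{i=0}^{e} (−1)^i Σ_{k₁+⋯+k_{i+1}=e+1, kⱼ>0} Π_j (2k_j)!/k_j!`. -/
theorem m1RG_eq_arques_beraud (e : ℕ) (he : 1 ≤ e) :
    (m1RG e : ℚ)
      = (1 / 2 ^ (e + 1)) *
        ∑ i ∈ Finset.range (e + 1), (-1 : ℚ) ^ i *
          ∑ κ ∈ (Finset.Nat.antidiagonalTuple (i + 1) (e + 1)).filter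
              (fun κ => ∀ j, 0 < κ j),
            ∏ j : Fin (i + 1), ((2 * κ j).factorial : ℚ) / ((κ j).factorial : ℚ) := by
  rw [eq_alternating_sum_of_convolution (m := fun n => (m1RG n : ℚ)) m1RG_convolution he,
    Finset.mul_sum]
  refine Finset.sum_congr rfl fun i _ => ?_
  rw [mul_left_comm (1 / 2 ^ (e + 1))]
  congr 1
  rw [Finset.mul_sum]
  refine Finset.sum_congr rfl fun κ hκ => ?_
  exact prod_matchingNumber (Finset.Nat.mem_antidiagonalTuple.1 (Finset.mem_filter.1 hκ).1)
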